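/- arXiv:math/0411405 — 2 statements merged into one kernel-verified Lean document; each statement's English description precedes it below -/
import Mathlib

section
/- Let F ∈ ℂ[X_0,…,X_{n+1}] be homogeneous of degree d ≥ 1 such that the partial derivatives ∂F/∂X_0,…,∂F/∂X_{n+1} have no common zero in ℂ^{n+2} other than the origin (i.e., the hypersurface V(F) ⊂ ℙ^{n+1} is smooth). Then for every k ≥ 0 the dimension of the degree-k graded piece R_k of the Jacobian ring equals the coefficient of t^k in the polynomial (1 + t + ⋯ + t^{d−2})^{n+2}; equivalently, ∑_{k≥0} (dim_ℂ R_k)·t^k = ((t^{d−1} − 1)/(t − 1))^{n+2}. -/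
open MvPolynomial

/-- The Jacobian ideal of `F`, generated by its partial derivatives. -/
noncomputable def jacobianIdeal (n : ℕ) (F : MvPolynomial (Fin (n + 2)) ℂ) :
    Ideal (MvPolynomial (Fin (n + 2)) ℂ) :=
  Ideal.span (Set.range fun i => pderiv i F)

/-- The degree-`k` graded piece `R_k = S_k/(J(F) ∩ S_k)` of the Jacobian ring,
realized as the image of `S_k` in `S/J(F)`. -/
noncomputable def jacobianRingPiece (n : ℕ) (F : MvPolynomial (Fin (n + 2)) ℂ) (k : ℕ) :
    Submodule ℂ (MvPolynomial (Fin (n + 2)) ℂ ⧸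
      Submodule.restrictScalars ℂ (jacobianIdeal n F)) :=
  Submodule.map (Submodule.restrictScalars ℂ (jacobianIdeal n F)).mkQ
    (homogeneousSubmodule (Fin (n + 2)) ℂ k)


section HilbertAux

/-- Ideals stable under taking homogeneous components. -/
def HomI {m : ℕ} (I : Ideal (MvPolynomial (Fin m) ℂ)) : Prop :=
  ∀ p ∈ I, ∀ k, homogeneousComponent k p ∈ I

lemma comp_mul_hom {m : ℕ} {a : MvPolynomial (Fin m) ℂ} {α : ℕ} (ha : a.IsHomogeneous α)
    (v : MvPolynomial (Fin m) ℂ) (k : ℕ) :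
    homogeneousComponent k (a * v) =
      if α ≤ k then a * homogeneousComponent (k - α) v else 0 := by
  induction v using MvPolynomial.induction_on' with
  | monomial u c =>
    have h1 := isHomogeneous_monomial (d := u) c rfl
    rw [homogeneousComponent_of_mem (ha.mul h1), homogeneousComponent_of_mem h1]
    split_ifs <;> first | rfl | omega | simp
  | add p q hp hq =>
    rw [mul_add, map_add, hp, hq, map_add]
    split_ifs <;> simp [mul_add]

lemma homI_bot {m : ℕ} : HomI (⊥ : Ideal (MvPolynomial (Fin m) ℂ)) := by
  intro p hp k
  rw [Ideal.mem_bot] at hp ⊢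
  simp [hp]

lemma mem_sup_span {m : ℕ} {I : Ideal (MvPolynomial (Fin m) ℂ)} {a p : MvPolynomial (Fin m) ℂ} :
    p ∈ I ⊔ Ideal.span {a} ↔ ∃ i ∈ I, ∃ v, p = i + a * v := by
  rw [Submodule.mem_sup]
  constructor
  · rintro ⟨i, hi, z, hz, rfl⟩
    obtain ⟨v, rfl⟩ := Ideal.mem_span_singleton'.1 hz
    exact ⟨i, hi, v, by ring⟩
  · rintro ⟨i, hi, v, rfl⟩
    exact ⟨i, hi, a * v, Ideal.mul_mem_right _ _ (Ideal.mem_span_singleton_self a), rfl⟩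

lemma homI_sup {m : ℕ} {I : Ideal (MvPolynomial (Fin m) ℂ)} (hI : HomI I)
    {a : MvPolynomial (Fin m) ℂ} {α : ℕ} (ha : a.IsHomogeneous α) :
    HomI (I ⊔ Ideal.span {a}) := by
  intro p hp k
  obtain ⟨i, hi, v, rfl⟩ := mem_sup_span.1 hp
  rw [map_add, comp_mul_hom ha]
  split_ifs
  · exact mem_sup_span.2 ⟨_, hI i hi k, _, rfl⟩
  · exact mem_sup_span.2 ⟨_, hI i hi k, 0, by simp⟩

/-- Multiplication by `a` is injective modulo `I`. -/
def RegE {m : ℕ} (I : Ideal (MvPolynomial (Fin m) ℂ)) (a : MvPolynomial (Fin m) ℂ) : Prop :=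
  ∀ u, a * u ∈ I → u ∈ I

/-- Regular sequences modulo `I`. -/
def RegL {m : ℕ} : Ideal (MvPolynomial (Fin m) ℂ) → List (MvPolynomial (Fin m) ℂ) → Prop
  | _, [] => True
  | I, a :: L => RegE I a ∧ RegL (I ⊔ Ideal.span {a}) L

lemma regE_swap1 {m : ℕ} {I : Ideal (MvPolynomial (Fin m) ℂ)} {a b : MvPolynomial (Fin m) ℂ}
    (h1 : RegE I a) (h2 : RegE (I ⊔ Ideal.span {a}) b) : RegE (I ⊔ Ideal.span {b}) a := by
  intro u hu
  obtain ⟨i, hi, v, hv⟩ := mem_sup_span.1 hu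
  have hbv : b * v ∈ I ⊔ Ideal.span {a} :=
    mem_sup_span.2 ⟨-i, neg_mem hi, u, by rw [hv]; ring⟩
  obtain ⟨j, hj, w, rfl⟩ := mem_sup_span.1 (h2 v hbv)
  have : u - b * w ∈ I := by
    apply h1
    have : a * (u - b * w) = i + b * j := by rw [mul_sub, hv]; ring
    rw [this]
    exact add_mem hi (Ideal.mul_mem_left _ _ hj)
  exact mem_sup_span.2 ⟨_, this, w, by ring⟩

lemma regE_swap2 {m : ℕ} {I : Ideal (MvPolynomial (Fin m) ℂ)} (hI : HomI I)
    {a b : MvPolynomial (Fin m) ℂ} {α : ℕ} (hα : 0 < α) (ha : a.IsHomogeneous α)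
    (h1 : RegE I a) (h2 : RegE (I ⊔ Ideal.span {a}) b) : RegE I b := by
  have key : ∀ s : ℕ, ∀ u, b * u ∈ I → ∃ i ∈ I, ∃ v, u = i + a ^ s * v := by
    intro s
    induction s with
    | zero => intro u _; exact ⟨0, zero_mem _, u, by simp⟩
    | succ s ih =>
      intro u hu
      obtain ⟨i, hi, v, rfl⟩ := mem_sup_span.1 (h2 u (Ideal.mem_sup_left hu))
      have hbv : b * v ∈ I := by
        apply h1
        have : a * (b * v) = b * (i + a * v) - b * i := by ring
        rw [this]
        exact sub_mem hu (Ideal.mul_mem_left _ _ hi)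
      obtain ⟨j, hj, w, rfl⟩ := ih v hbv
      exact ⟨i + a * j, add_mem hi (Ideal.mul_mem_left _ _ hj), w, by ring⟩
  intro u hu
  rw [← sum_homogeneousComponent u]
  refine Ideal.sum_mem _ fun k _ => ?_
  obtain ⟨i, hi, v, rfl⟩ := key (k + 1) u hu
  rw [map_add, comp_mul_hom (ha.pow (k + 1)), if_neg (by nlinarith), add_zero]
  exact hI i hi k

/-- All members are homogeneous of positive degree. -/
def HomL {m : ℕ} (L : List (MvPolynomial (Fin m) ℂ)) : Prop :=
  ∀ a ∈ L, ∃ α : ℕ, 0 < α ∧ a.IsHomogeneous α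

lemma regL_move {m : ℕ} (L : List (MvPolynomial (Fin m) ℂ)) :
    ∀ (I : Ideal (MvPolynomial (Fin m) ℂ)) (_ : HomI I) (a : MvPolynomial (Fin m) ℂ)
    (_ : HomL (a :: L)), RegL I (a :: L) → RegL I (L ++ [a]) := by
  induction L with
  | nil => intro I hI a hL h; exact h
  | cons b L ih =>
    intro I hI a hL h
    obtain ⟨h1, h2, h3⟩ := h
    obtain ⟨α, hα, ha⟩ := hL a (by simp)
    obtain ⟨β, hβ, hb⟩ := hL b (by simp)
    refine ⟨regE_swap2 hI hα ha h1 h2, ih _ (homI_sup hI hb) a ?_ ⟨regE_swap1 h1 h2, ?_⟩⟩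
    · intro c hc
      apply hL
      simp only [List.mem_cons] at hc ⊢
      tauto
    · rwa [sup_right_comm]

/-- The ideal generated by a list. -/
noncomputable def spanL {m : ℕ} (L : List (MvPolynomial (Fin m) ℂ)) : Ideal (MvPolynomial (Fin m) ℂ) :=
  Ideal.span {p | p ∈ L}

lemma spanL_cons {m : ℕ} (a : MvPolynomial (Fin m) ℂ) (L : List (MvPolynomial (Fin m) ℂ)) :
    spanL (a :: L) = Ideal.span {a} ⊔ spanL L := by
  unfold spanL
  rw [← Ideal.span_union]
  congr 1
  ext p
  simp

lemma regL_append_single {m : ℕ} (L : List (MvPolynomial (Fin m) ℂ)) :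
    ∀ (I : Ideal (MvPolynomial (Fin m) ℂ)) (a : MvPolynomial (Fin m) ℂ),
    RegL I (L ++ [a]) ↔ RegL I L ∧ RegE (I ⊔ spanL L) a := by
  induction L with
  | nil => intro I a; simp [RegL, spanL]
  | cons b L ih =>
    intro I a
    simp only [List.cons_append, RegL, ih, spanL_cons, sup_assoc, and_assoc]

lemma regL_exchange {m : ℕ} (L : List (MvPolynomial (Fin m) ℂ)) (a b : MvPolynomial (Fin m) ℂ)
    (h : RegL ⊥ (L ++ [a])) (s : ℕ) (hs : a ^ s ∈ spanL L ⊔ Ideal.span {b}) :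
    RegL ⊥ (L ++ [b]) := by
  rw [regL_append_single, bot_sup_eq] at h ⊢
  refine ⟨h.1, fun u hu => ?_⟩
  obtain ⟨i, hi, c, hc⟩ := mem_sup_span.1 hs
  have h1 : ∀ s : ℕ, a ^ s * u ∈ spanL L → u ∈ spanL L := by
    intro s
    induction s with
    | zero => simp
    | succ s ih =>
      intro h'
      refine ih (h.2 _ ?_)
      rwa [← mul_assoc, ← pow_succ']
  apply h1 s
  have : a ^ s * u = u * i + c * (b * u) := by rw [hc]; ring
  rw [this]
  exact add_mem (Ideal.mul_mem_left _ _ hi) (Ideal.mul_mem_left _ _ hu)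

/-- No common zero but the origin. -/
def Hsop {m : ℕ} (L : List (MvPolynomial (Fin m) ℂ)) : Prop :=
  ∀ x : Fin m → ℂ, (∀ g ∈ L, eval x g = 0) → x = 0

lemma hsop_radical {m : ℕ} {L : List (MvPolynomial (Fin m) ℂ)} (h : Hsop L)
    (p : MvPolynomial (Fin m) ℂ) (hp : eval 0 p = 0) : p ∈ (spanL L).radical := by
  rw [← vanishingIdeal_zeroLocus_eq_radical (K := ℂ), mem_vanishingIdeal_iff]
  intro x hx
  have : x = 0 := by
    apply h
    intro g hg
    exact hx g (Ideal.subset_span hg)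
  subst this
  exact hp

/-- Linear form with given coefficients. -/
noncomputable def linF {m : ℕ} : (Fin m → ℂ) →ₗ[ℂ] MvPolynomial (Fin m) ℂ :=
  Fintype.linearCombination ℂ (fun i => (X i : MvPolynomial (Fin m) ℂ))

lemma linF_apply {m : ℕ} (c : Fin m → ℂ) : linF c = ∑ i, c i • (X i : MvPolynomial (Fin m) ℂ) := rfl

lemma linF_hom {m : ℕ} (c : Fin m → ℂ) : (linF c).IsHomogeneous 1 := by
  rw [linF_apply]
  refine IsHomogeneous.sum _ _ _ fun i _ => ?_
  rw [smul_eq_C_mul]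
  exact (isHomogeneous_X ℂ i).C_mul _

lemma linF_eval {m : ℕ} (c x : Fin m → ℂ) : eval x (linF c) = ∑ i, c i * x i := by
  simp [linF_apply, smul_eval]

lemma linF_single {m : ℕ} (i : Fin m) : linF (Pi.single i 1) = X i := by
  simp [linF, Fintype.linearCombination_apply_single]

/-- Restriction of polynomials to the line through `x`. -/
noncomputable def lineMap {m : ℕ} (x : Fin m → ℂ) : MvPolynomial (Fin m) ℂ →ₐ[ℂ] Polynomial ℂ :=
  aeval fun i => Polynomial.C (x i) * Polynomial.X

lemma lineMap_hom {m : ℕ} (x : Fin m → ℂ) {p : MvPolynomial (Fin m) ℂ} {k : ℕ}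
    (hp : p.IsHomogeneous k) : lineMap x p = Polynomial.C (eval x p) * Polynomial.X ^ k := by
  unfold lineMap
  rw [aeval_def, eval₂_eq, eval_eq, map_sum, Finset.sum_mul]
  refine Finset.sum_congr rfl fun d hd => ?_
  have hk : ∑ i ∈ d.support, d i = k := (hp.degree_eq_sum_deg_support hd).symm
  simp only [mul_pow, Finset.prod_mul_distrib, Finset.prod_pow_eq_pow_sum, hk, map_mul, map_prod,
    map_pow, Polynomial.algebraMap_eq]
  ring

lemma exists_linear {m : ℕ} (L : List (MvPolynomial (Fin m) ℂ)) (hL : HomL L)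
    (b : MvPolynomial (Fin m) ℂ) (hb : ∃ β : ℕ, 0 < β ∧ b.IsHomogeneous β)
    (h : Hsop (L ++ [b])) : ∃ c : Fin m → ℂ, Hsop (linF c :: L) := by
  classical
  have hfin := (spanL L).finite_minimalPrimes_of_isNoetherianRing
  set s : Set (Submodule ℂ (Fin m → ℂ)) :=
    (fun P : Ideal (MvPolynomial (Fin m) ℂ) => (P.restrictScalars ℂ).comap linF) ''
      (spanL L).minimalPrimes \ {⊤} with hs
  have hsf : s.Finite := (hfin.image _).subset Set.sdiff_subset
  have hne := Subspace.biUnion_ne_univ_of_top_notMem (s := hsf.toFinset) (by simp [hs])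
  obtain ⟨c, hc⟩ := (Set.ne_univ_iff_exists_notMem _).1 hne
  refine ⟨c, fun x hx => ?_⟩
  by_contra hx0
  obtain ⟨j, hj⟩ : ∃ j, x j ≠ 0 := by
    by_contra hcon
    push Not at hcon
    exact hx0 (funext hcon)
  set Q : Ideal (MvPolynomial (Fin m) ℂ) := RingHom.ker (lineMap x) with hQ
  have hQp : Q.IsPrime := RingHom.ker_isPrime _
  set M : Ideal (MvPolynomial (Fin m) ℂ) := RingHom.ker (eval (0 : Fin m → ℂ)) with hM
  have hMp : M.IsPrime := RingHom.ker_isPrime _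
  have hXj : X j ∉ Q := by
    rw [hQ, RingHom.mem_ker, lineMap_hom x (isHomogeneous_X ℂ j)]
    simp [hj]
  have eval0 : ∀ p : MvPolynomial (Fin m) ℂ, (∃ α : ℕ, 0 < α ∧ p.IsHomogeneous α) → p ∈ M := by
    rintro p ⟨α, hα, hp⟩
    rw [hM, RingHom.mem_ker]
    change eval (fun _ => (0 : ℂ)) p = 0
    rw [eval_zero', constantCoeff_eq]
    exact hp.coeff_eq_zero (by simpa using hα.ne)
  have hQM : Q < M := by
    refine lt_of_le_of_ne ?_ ?_
    · intro p hp
      rw [hQ, RingHom.mem_ker] at hp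
      have h2 : ((Polynomial.aeval (0:ℂ)).comp (lineMap x)) = aeval (0 : Fin m → ℂ) := by
        ext i
        simp [lineMap]
      have := congrArg (Polynomial.aeval (0:ℂ)) hp
      rw [hM, RingHom.mem_ker]
      change ((Polynomial.aeval (0:ℂ)).comp (lineMap x)) p = _ at this
      rw [h2] at this
      simpa using this
    · intro he
      apply hXj
      rw [he]
      exact eval0 _ ⟨1, one_pos, isHomogeneous_X ℂ j⟩
  have hLQ : {p | p ∈ L} ⊆ (Q : Set (MvPolynomial (Fin m) ℂ)) := by
    intro p hp
    obtain ⟨α, hα, hpa⟩ := hL p hp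
    rw [SetLike.mem_coe, hQ, RingHom.mem_ker, lineMap_hom x hpa, hx p (by simp [show p ∈ L from hp])]
    simp
  have heq : insert b {p | p ∈ L} = {p | p ∈ L ++ [b]} := by
    ext p; simp [or_comm]
  have hmin : M ∈ (Ideal.span (insert b {p | p ∈ L})).minimalPrimes := by
    refine ⟨⟨hMp, ?_⟩, ?_⟩
    · rw [Ideal.span_le]
      rintro p (rfl | hp)
      · exact eval0 _ hb
      · exact eval0 _ (hL p hp)
    · rintro P ⟨hP, hPle⟩ _ p hp
      rw [heq] at hPle
      have := hsop_radical h p hp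
      exact hP.radical_le_iff.2 hPle this
  have hQmin := Ideal.mem_minimalPrimes_span_of_mem_minimalPrimes_span_insert hQM b
    {p | p ∈ L} hmin {p | p ∈ L} hLQ
    (fun p hp => Ideal.le_radical (Ideal.subset_span (Set.mem_insert_of_mem _ hp)))
  apply hc
  simp only [Set.mem_iUnion]
  refine ⟨(Q.restrictScalars ℂ).comap linF, ?_, ?_⟩
  · rw [Set.Finite.mem_toFinset]
    refine ⟨⟨Q, hQmin, rfl⟩, fun htop => hXj ?_⟩
    have : Pi.single j 1 ∈ (Q.restrictScalars ℂ).comap linF := by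
      rw [Set.mem_singleton_iff.1 htop]; trivial
    simpa [linF_single] using this
  · change linF c ∈ Q
    rw [hQ, RingHom.mem_ker, lineMap_hom x (linF_hom c), hx _ (by simp)]
    simp

lemma regE_X {m : ℕ} (T : Set (Fin m)) (j : Fin m) (hj : j ∉ T) :
    RegE (Ideal.span ((X : Fin m → MvPolynomial (Fin m) ℂ) '' T)) (X j) := by
  intro u hu
  rw [mem_ideal_span_X_image] at hu ⊢
  intro d hd
  obtain ⟨i, hi, hdi⟩ := hu (Finsupp.single j 1 + d) (by
    rw [mem_support_iff, coeff_X_mul]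
    exact mem_support_iff.1 hd)
  refine ⟨i, hi, ?_⟩
  have hij : j ≠ i := fun h => hj (h ▸ hi)
  simpa [Finsupp.single_apply, hij] using hdi

lemma regL_X_aux {m : ℕ} (js : List (Fin m)) : ∀ (T : Set (Fin m)), js.Nodup → (∀ j ∈ js, j ∉ T) →
    RegL (Ideal.span ((X : Fin m → MvPolynomial (Fin m) ℂ) '' T)) (js.map X) := by
  induction js with
  | nil => intro T _ _; trivial
  | cons j js ih =>
    intro T hnd hT
    rw [List.nodup_cons] at hnd
    refine ⟨regE_X T j (hT j (by simp)), ?_⟩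
    have h := ih (insert j T) hnd.2 (by
      intro i hi hmem
      rcases hmem with rfl | hmem
      · exact hnd.1 hi
      · exact hT i (by simp [hi]) hmem)
    rwa [Set.image_insert_eq, Ideal.span_insert, sup_comm] at h

lemma regL_X {m : ℕ} : RegL (⊥ : Ideal (MvPolynomial (Fin m) ℂ)) (List.ofFn X) := by
  have h := regL_X_aux (List.finRange m) ∅ (List.nodup_finRange m) (by simp)
  rw [List.ofFn_eq_map]
  simpa using h

lemma regL_map {m : ℕ} (φ : MvPolynomial (Fin m) ℂ ≃ₐ[ℂ] MvPolynomial (Fin m) ℂ)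
    (L : List (MvPolynomial (Fin m) ℂ)) : ∀ I : Ideal (MvPolynomial (Fin m) ℂ), RegL I L →
    RegL (I.comap φ.symm) (L.map φ) := by
  induction L with
  | nil => intro I _; trivial
  | cons a L ih =>
    intro I h
    refine ⟨?_, ?_⟩
    · intro u hu
      rw [Ideal.mem_comap] at hu ⊢
      rw [map_mul, AlgEquiv.symm_apply_apply] at hu
      exact h.1 _ hu
    · have h2 := ih _ h.2
      convert h2 using 1
      ext p
      rw [mem_sup_span, Ideal.mem_comap, mem_sup_span]
      constructor
      · rintro ⟨i, hi, v, rfl⟩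
        exact ⟨_, hi, φ.symm v, by simp⟩
      · rintro ⟨i, hi, v, hv⟩
        refine ⟨φ i, by simpa using hi, φ v, ?_⟩
        rw [← map_mul, ← map_add, ← hv, AlgEquiv.apply_symm_apply]

lemma aeval_linF {m : ℕ} (A : Matrix (Fin m) (Fin m) ℂ) (c : Fin m → ℂ) :
    aeval (fun i => linF (A i)) (linF c) = linF (Matrix.vecMul c A) := by
  rw [linF_apply c, map_sum]
  simp only [map_smul, aeval_X]
  rw [Matrix.vecMul_eq_sum, map_sum]
  simp

lemma aeval_linF_comp {m : ℕ} (A B : Matrix (Fin m) (Fin m) ℂ) (h : B * A = 1) :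
    (aeval (fun i => linF (A i))).comp (aeval (fun i => linF (B i))) =
      AlgHom.id ℂ (MvPolynomial (Fin m) ℂ) := by
  apply MvPolynomial.algHom_ext
  intro i
  simp only [AlgHom.comp_apply, aeval_X, aeval_linF, AlgHom.id_apply]
  have : Matrix.vecMul (B i) A = Pi.single i 1 := by
    rw [← Matrix.mul_apply_eq_vecMul, h]
    ext j
    simp [Matrix.one_apply, Pi.single_apply, eq_comm]
  rw [this, linF_single]

lemma regL_linear {m : ℕ} (cs : List (Fin m → ℂ)) (hlen : cs.length = m)
    (h : Hsop (cs.map linF)) : RegL ⊥ (cs.map linF) := by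
  set A : Matrix (Fin m) (Fin m) ℂ := fun i => cs.get (Fin.cast hlen.symm i) with hA
  have hofn : cs.map linF = List.ofFn (fun i => linF (A i)) := by
    apply List.ext_get
    · simp [hlen]
    · intro i h1 h2
      simp [hA]
  have hU : IsUnit A := by
    rw [← Matrix.mulVec_injective_iff_isUnit]
    rw [← Matrix.coe_mulVecLin, ← LinearMap.ker_eq_bot, LinearMap.ker_eq_bot']
    intro x hx
    apply h
    intro g hg
    rw [hofn, List.mem_ofFn] at hg
    obtain ⟨i, rfl⟩ := hg
    rw [linF_eval]
    exact congrFun hx i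
  have hdet := (Matrix.isUnit_iff_isUnit_det A).1 hU
  let φ := AlgEquiv.ofAlgHom _ _ (aeval_linF_comp A A⁻¹ (Matrix.nonsing_inv_mul A hdet))
    (aeval_linF_comp A⁻¹ A (Matrix.mul_nonsing_inv A hdet))
  have h1 := regL_map φ _ _ (regL_X (m := m))
  have h2 : (⊥ : Ideal (MvPolynomial (Fin m) ℂ)).comap φ.symm = ⊥ := by
    ext p
    simp
  have h3 : (List.ofFn X).map φ = cs.map linF := by
    rw [hofn, List.map_ofFn]
    congr 1
    ext i : 1
    simp [φ]
  rwa [h2, h3] at h1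

lemma regL_of_hsop {m : ℕ} (G : List (MvPolynomial (Fin m) ℂ)) : ∀ (_ : HomL G)
    (cs : List (Fin m → ℂ)), cs.length + G.length = m → Hsop (cs.map linF ++ G) →
    RegL ⊥ (cs.map linF ++ G) := by
  induction G using List.reverseRecOn with
  | nil =>
    intro _ cs hlen h
    simp only [List.append_nil] at h ⊢
    exact regL_linear cs (by simpa using hlen) h
  | append_singleton G b ih =>
    intro hG cs hlen h
    rw [← List.append_assoc] at h ⊢
    have hG' : HomL G := fun a ha => hG a (by simp [ha])
    have hlin : HomL (cs.map linF) := by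
      intro a ha
      obtain ⟨c, _, rfl⟩ := List.mem_map.1 ha
      exact ⟨1, one_pos, linF_hom c⟩
    have hall : HomL (cs.map linF ++ G) := by
      intro a ha
      rcases List.mem_append.1 ha with ha | ha
      · exact hlin a ha
      · exact hG' a ha
    obtain ⟨c, hc⟩ := exists_linear _ hall b (hG b (by simp)) h
    have h1 : RegL ⊥ (linF c :: (cs.map linF ++ G)) := by
      have := ih hG' (c :: cs) (by simp at hlen ⊢; omega) (by simpa using hc)
      simpa using this
    have h2 := regL_move _ _ homI_bot _ (by
      intro a ha
      rcases List.mem_cons.1 ha with rfl | ha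
      · exact ⟨1, one_pos, linF_hom c⟩
      · exact hall a ha) h1
    obtain ⟨s, hs⟩ := hsop_radical h (linF c) (by rw [linF_eval]; simp)
    refine regL_exchange _ _ b h2 s ?_
    convert hs using 1
    unfold spanL
    rw [← Ideal.span_union]
    congr 1
    ext p
    simp only [Set.union_singleton, Set.mem_insert_iff, Set.mem_ofPred_eq, List.mem_append,
      List.mem_singleton]
    tauto

instance homFin {m : ℕ} (k : ℕ) : FiniteDimensional ℂ (homogeneousSubmodule (Fin m) ℂ k) :=
  Module.Finite.iff_fg.2 (homogeneousSubmodule_fg (Fin m) ℂ k)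

/-- Degree-`k` piece of an ideal. -/
noncomputable def pc {m : ℕ} (I : Ideal (MvPolynomial (Fin m) ℂ)) (k : ℕ) :
    Submodule ℂ (MvPolynomial (Fin m) ℂ) :=
  homogeneousSubmodule (Fin m) ℂ k ⊓ I.restrictScalars ℂ

instance pcFin {m : ℕ} (I : Ideal (MvPolynomial (Fin m) ℂ)) (k : ℕ) :
    FiniteDimensional ℂ (pc I k) :=
  Submodule.finiteDimensional_of_le (inf_le_left : pc I k ≤ homogeneousSubmodule (Fin m) ℂ k)

lemma mem_pc {m : ℕ} {I : Ideal (MvPolynomial (Fin m) ℂ)} {k : ℕ} {p : MvPolynomial (Fin m) ℂ} :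
    p ∈ pc I k ↔ p.IsHomogeneous k ∧ p ∈ I := Iff.rfl

lemma pc_top {m : ℕ} (k : ℕ) : pc (⊤ : Ideal (MvPolynomial (Fin m) ℂ)) k =
    homogeneousSubmodule (Fin m) ℂ k :=
  le_antisymm inf_le_left fun _ hp => ⟨hp, Submodule.mem_top⟩

lemma pc_lt {m : ℕ} {I : Ideal (MvPolynomial (Fin m) ℂ)} (hI : HomI I)
    {a : MvPolynomial (Fin m) ℂ} {α : ℕ} (ha : a.IsHomogeneous α) (k : ℕ) (hk : k < α) :
    pc (I ⊔ Ideal.span {a}) k = pc I k := by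
  ext p
  rw [mem_pc, mem_pc]
  refine and_congr_right fun hp => ⟨fun h => ?_, fun h => Ideal.mem_sup_left h⟩
  obtain ⟨i, hi, v, rfl⟩ := mem_sup_span.1 h
  rw [← homogeneousComponent_eq_self hp, map_add, comp_mul_hom ha, if_neg (by omega), add_zero]
  exact hI i hi k

lemma pc_ge {m : ℕ} {I : Ideal (MvPolynomial (Fin m) ℂ)} (hI : HomI I)
    {a : MvPolynomial (Fin m) ℂ} {α : ℕ} (ha : a.IsHomogeneous α) (hr : RegE I a) (k : ℕ) :
    Module.finrank ℂ (pc (I ⊔ Ideal.span {a}) (α + k)) + Module.finrank ℂ (pc I k) =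
      Module.finrank ℂ (pc I (α + k)) + Module.finrank ℂ (homogeneousSubmodule (Fin m) ℂ k) := by
  by_cases ha0 : a = 0
  · have hI1 : I = ⊤ := by
      rw [Ideal.eq_top_iff_one]
      apply hr
      simp [ha0]
    subst hI1
    rw [top_sup_eq]
    rw [pc_top, pc_top]
  set μ : MvPolynomial (Fin m) ℂ →ₗ[ℂ] MvPolynomial (Fin m) ℂ := LinearMap.mulLeft ℂ a with hμ
  have hinj : Function.Injective μ := fun u v h => mul_left_cancel₀ ha0 h
  have h1 : pc I (α + k) ⊔ (homogeneousSubmodule (Fin m) ℂ k).map μ =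
      pc (I ⊔ Ideal.span {a}) (α + k) := by
    apply le_antisymm
    · refine sup_le ?_ ?_
      · intro p hp
        exact ⟨hp.1, Ideal.mem_sup_left hp.2⟩
      · rintro _ ⟨v, hv, rfl⟩
        exact ⟨ha.mul hv, Ideal.mem_sup_right
          (Ideal.mul_mem_right _ _ (Ideal.mem_span_singleton_self a))⟩
    · rintro p ⟨hp, hp2⟩
      obtain ⟨i, hi, v, rfl⟩ := mem_sup_span.1 hp2
      rw [← homogeneousComponent_eq_self hp, map_add, comp_mul_hom ha, if_pos (by omega)]
      refine Submodule.add_mem_sup ⟨homogeneousComponent_mem _ _, hI i hi _⟩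
        ⟨_, ?_, rfl⟩
      have := homogeneousComponent_mem (α + k - α) v
      rwa [Nat.add_sub_cancel_left] at this ⊢
  have h2 : pc I (α + k) ⊓ (homogeneousSubmodule (Fin m) ℂ k).map μ = (pc I k).map μ := by
    ext p
    constructor
    · rintro ⟨hp, v, hv, rfl⟩
      exact ⟨v, ⟨hv, hr v hp.2⟩, rfl⟩
    · rintro ⟨v, hv, rfl⟩
      exact ⟨⟨ha.mul hv.1, Ideal.mul_mem_left _ _ hv.2⟩, v, hv.1, rfl⟩
  have h3 := Submodule.finrank_sup_add_finrank_inf_eq (pc I (α + k))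
    ((homogeneousSubmodule (Fin m) ℂ k).map μ)
  rw [h1, h2, ← (Submodule.equivMapOfInjective μ hinj _).finrank_eq,
    ← (Submodule.equivMapOfInjective μ hinj _).finrank_eq] at h3
  exact h3

/-- Hilbert series of the quotient by `I`. -/
noncomputable def Hs {m : ℕ} (I : Ideal (MvPolynomial (Fin m) ℂ)) : PowerSeries ℤ :=
  PowerSeries.mk fun k => (Module.finrank ℂ (homogeneousSubmodule (Fin m) ℂ k) : ℤ) -
    Module.finrank ℂ (pc I k)

lemma Hs_step {m : ℕ} {I : Ideal (MvPolynomial (Fin m) ℂ)} (hI : HomI I)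
    {a : MvPolynomial (Fin m) ℂ} {α : ℕ} (ha : a.IsHomogeneous α) (hr : RegE I a) :
    Hs (I ⊔ Ideal.span {a}) + PowerSeries.X ^ α * Hs I = Hs I := by
  ext k
  rw [map_add, PowerSeries.coeff_X_pow_mul']
  simp only [Hs, PowerSeries.coeff_mk]
  split_ifs with h
  · obtain ⟨j, rfl⟩ := Nat.exists_eq_add_of_le h
    rw [Nat.add_sub_cancel_left]
    have := pc_ge hI ha hr j
    zify at this
    linarith
  · rw [pc_lt hI ha k (by omega), add_zero]

lemma Hs_list {m α : ℕ} (L : List (MvPolynomial (Fin m) ℂ)) :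
    ∀ (I : Ideal (MvPolynomial (Fin m) ℂ)) (_ : HomI I) (_ : ∀ a ∈ L, a.IsHomogeneous α),
    RegL I L → Hs (I ⊔ spanL L) = (1 - PowerSeries.X ^ α) ^ L.length * Hs I := by
  induction L with
  | nil => intro I _ _ _; simp [spanL]
  | cons a L ih =>
    intro I hI hL h
    have ha := hL a (by simp)
    rw [spanL_cons, ← sup_assoc, ih _ (homI_sup hI ha) (fun b hb => hL b (by simp [hb])) h.2,
      List.length_cons, pow_succ, mul_assoc]
    congr 1
    linear_combination Hs_step hI ha h.1

lemma Hs_X {m : ℕ} : Hs (spanL (List.ofFn (X : Fin m → MvPolynomial (Fin m) ℂ))) = 1 := by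
  have hset : {p | p ∈ List.ofFn (X : Fin m → MvPolynomial (Fin m) ℂ)} =
      (X : Fin m → MvPolynomial (Fin m) ℂ) '' Set.univ := by
    ext p
    simp [List.mem_ofFn]
  unfold spanL
  rw [hset]
  ext k
  simp only [Hs, PowerSeries.coeff_mk, PowerSeries.coeff_one]
  split_ifs with hk
  · subst hk
    have h0 : pc (Ideal.span ((X : Fin m → MvPolynomial (Fin m) ℂ) '' Set.univ)) 0 = ⊥ := by
      rw [eq_bot_iff]
      rintro p ⟨hp, hp2⟩
      rw [Submodule.mem_bot]
      by_contra hne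
      obtain ⟨d, hd⟩ := Finset.nonempty_iff_ne_empty.2 (fun h => hne (support_eq_empty.1 h))
      obtain ⟨i, _, hi⟩ := mem_ideal_span_X_image.1 hp2 d hd
      have hdeg : d.degree = 0 := by
        by_contra hcon
        exact mem_support_iff.1 hd (IsHomogeneous.coeff_eq_zero hp hcon)
      rw [Finsupp.degree_eq_zero_iff] at hdeg
      simp [hdeg] at hi
    have h1 : Module.finrank ℂ (homogeneousSubmodule (Fin m) ℂ 0) = 1 := by
      rw [homogeneousSubmodule_zero, Submodule.one_eq_span]
      exact finrank_span_singleton one_ne_zero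
    rw [h0, h1]
    simp
  · have h0 : pc (Ideal.span ((X : Fin m → MvPolynomial (Fin m) ℂ) '' Set.univ)) k =
        homogeneousSubmodule (Fin m) ℂ k := by
      refine le_antisymm inf_le_left fun p hp => ⟨hp, ?_⟩
      refine mem_ideal_span_X_image.2 fun d hd => ?_
      by_contra hcon
      push Not at hcon
      have hd0 : d = 0 := by
        ext i
        exact hcon i trivial
      refine mem_support_iff.1 hd (IsHomogeneous.coeff_eq_zero hp ?_)
      rw [hd0]
      simpa using Ne.symm hk
    rw [h0]
    simp

lemma finrank_piece (n : ℕ) (F : MvPolynomial (Fin (n + 2)) ℂ) (k : ℕ) :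
    Module.finrank ℂ (jacobianRingPiece n F k) + Module.finrank ℂ (pc (jacobianIdeal n F) k) =
      Module.finrank ℂ (homogeneousSubmodule (Fin (n + 2)) ℂ k) := by
  set f := (Submodule.restrictScalars ℂ (jacobianIdeal n F)).mkQ.domRestrict
    (homogeneousSubmodule (Fin (n + 2)) ℂ k) with hf
  have h := LinearMap.finrank_range_add_finrank_ker f
  have h1 : LinearMap.range f = jacobianRingPiece n F k := by
    rw [hf, LinearMap.range_domRestrict]
    rfl
  have h2 : (LinearMap.ker f).map (homogeneousSubmodule (Fin (n + 2)) ℂ k).subtype =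
      pc (jacobianIdeal n F) k := by
    ext p
    constructor
    · rintro ⟨⟨v, hv⟩, hv2, rfl⟩
      exact ⟨hv, (Submodule.Quotient.mk_eq_zero _).1 hv2⟩
    · rintro ⟨hp, hp2⟩
      exact ⟨⟨p, hp⟩, (Submodule.Quotient.mk_eq_zero _).2 hp2, rfl⟩
  rw [h1, (Submodule.equivMapOfInjective _ (Submodule.subtype_injective _) _).finrank_eq, h2] at h
  exact h

lemma Hs_jac (n e : ℕ) (he : 0 < e) (F : MvPolynomial (Fin (n + 2)) ℂ)
    (hF : ∀ i, (pderiv i F).IsHomogeneous e)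
    (hsm : ∀ x : Fin (n + 2) → ℂ, (∀ i, eval x (pderiv i F) = 0) → x = 0) :
    Hs (jacobianIdeal n F) = (∑ i ∈ Finset.range e, (PowerSeries.X : PowerSeries ℤ) ^ i) ^ (n + 2) := by
  set G := List.ofFn fun i => pderiv i F with hG
  have hmem : ∀ a ∈ G, a.IsHomogeneous e := by
    intro a ha
    rw [hG, List.mem_ofFn] at ha
    obtain ⟨i, rfl⟩ := ha
    exact hF i
  have hspan : jacobianIdeal n F = spanL G := by
    unfold jacobianIdeal spanL
    congr 1
    ext p
    change p ∈ Set.range _ ↔ p ∈ G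
    rw [hG, List.mem_ofFn]
    exact Iff.rfl
  have hreg : RegL ⊥ G := by
    have := regL_of_hsop G (fun a ha => ⟨e, he, hmem a ha⟩) [] (by simp [hG]) (by
      intro x hx
      refine hsm x fun i => hx _ ?_
      simp only [List.map_nil, List.nil_append, hG, List.mem_ofFn]
      exact ⟨i, rfl⟩)
    simpa using this
  have h1 := Hs_list (α := e) G ⊥ homI_bot hmem hreg
  have h2 := Hs_list (α := 1) (List.ofFn (X : Fin (n + 2) → MvPolynomial (Fin (n + 2)) ℂ)) ⊥
    homI_bot (by
      intro a ha
      rw [List.mem_ofFn] at ha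
      obtain ⟨i, rfl⟩ := ha
      exact isHomogeneous_X ℂ i) regL_X
  rw [bot_sup_eq, Hs_X, List.length_ofFn, pow_one] at h2
  rw [bot_sup_eq, ← hspan, hG, List.length_ofFn, ← mul_neg_geom_sum, mul_pow] at h1
  rw [h1]
  linear_combination -(∑ i ∈ Finset.range e, (PowerSeries.X : PowerSeries ℤ) ^ i) ^ (n + 2) * h2

end HilbertAux

theorem hilbert_series_of_jacobian_ring_smooth
    (n d : ℕ) (hd : 1 ≤ d) (F : MvPolynomial (Fin (n + 2)) ℂ)
    (hF : F.IsHomogeneous d)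
    (hsm : ∀ x : Fin (n + 2) → ℂ, (∀ i, eval x (pderiv i F) = 0) → x = 0)
    (k : ℕ) :
    Module.finrank ℂ (jacobianRingPiece n F k) =
      ((∑ i ∈ Finset.range (d - 1), (Polynomial.X : Polynomial ℕ) ^ i) ^ (n + 2)).coeff k := by
  have hder : ∀ i, (pderiv i F).IsHomogeneous (d - 1) := fun i => hF.pderiv
  have hk := finrank_piece n F k
  rcases Nat.eq_zero_or_pos (d - 1) with h0 | hpos
  · have htop : jacobianIdeal n F = ⊤ := by
      have hex : ∃ i, pderiv i F ≠ 0 := by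
        by_contra hcon
        push Not at hcon
        have := congrFun (hsm (fun _ => 1) (fun i => by rw [hcon i, map_zero])) 0
        simp at this
      obtain ⟨i, hi⟩ := hex
      have h1 := hder i
      rw [h0, ← totalDegree_zero_iff_isHomogeneous, totalDegree_eq_zero_iff_eq_C] at h1
      have hmem : pderiv i F ∈ jacobianIdeal n F := Ideal.subset_span ⟨i, rfl⟩
      refine Ideal.eq_top_of_isUnit_mem _ hmem ?_
      rw [h1]
      refine IsUnit.map C (IsUnit.mk0 _ fun hz => hi ?_)
      rw [h1, hz, map_zero]
    have hpc : pc (jacobianIdeal n F) k = homogeneousSubmodule (Fin (n + 2)) ℂ k := by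
      rw [htop, pc_top]
    rw [hpc] at hk
    rw [h0]
    simp
    omega
  · have h := congrArg (PowerSeries.coeff k) (Hs_jac n (d - 1) hpos F hder hsm)
    simp only [Hs, PowerSeries.coeff_mk] at h
    have hq : (∑ i ∈ Finset.range (d - 1), (PowerSeries.X : PowerSeries ℤ) ^ i) ^ (n + 2) =
        ((((∑ i ∈ Finset.range (d - 1), (Polynomial.X : Polynomial ℕ) ^ i) ^ (n + 2)).map
          (Nat.castRingHom ℤ) : Polynomial ℤ) : PowerSeries ℤ) := by
      rw [← Polynomial.coeToPowerSeries.ringHom_apply]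
      rw [Polynomial.map_pow, Polynomial.map_sum, map_pow, map_sum]
      simp
    rw [hq, Polynomial.coeff_coe, Polynomial.coeff_map] at h
    simp only [eq_natCast] at h
    zify at hk ⊢
    linarith
end

section
/- Let n ≥ 1 and let F ∈ ℂ[X_0,…,X_{n+1}] be homogeneous of degree d ≥ 1 such that the partial derivatives ∂F/∂X_0,…,∂F/∂X_{n+1} have no common zero in ℂ^{n+2} other than the origin. If (A_0,…,A_{n+1}) ∈ S_{d−n−1}^{⊕(n+2)} satisfies ∑_{i=0}^{n+1} A_i·∂F/∂X_i ∈ F·S_{d−n−2}, then there exists B ∈ S_{d−n−2} with A_i = X_i·B for all i. In other words, ker(h) = im(E). -/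
open MvPolynomial

/-- The space `S_k` of homogeneous polynomials of (integer) degree `k`,
with `S_k = 0` for `k < 0`. -/
noncomputable def gradedPiece (n : ℕ) (k : ℤ) :
    Submodule ℂ (MvPolynomial (Fin (n + 2)) ℂ) :=
  if 0 ≤ k then homogeneousSubmodule (Fin (n + 2)) ℂ k.toNat else ⊥

namespace KoszulAux

/-- The Koszul differential on the exterior algebra attached to a linear form. -/
noncomputable abbrev del {R M : Type*} [CommRing R] [AddCommGroup M] [Module R M]
    (φ : Module.Dual R M) : ExteriorAlgebra R M →ₗ[R] ExteriorAlgebra R M :=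
  CliffordAlgebra.contractLeft (Q := (0 : QuadraticForm R M)) φ

lemma map_mem_smul_top {R K L : Type*} [CommRing R] [AddCommGroup K] [Module R K]
    [AddCommGroup L] [Module R L] (g : K →ₗ[R] L) (I : Ideal R) {x : K}
    (hx : x ∈ I • (⊤ : Submodule R K)) : g x ∈ I • (⊤ : Submodule R L) := by
  have h := Submodule.mem_map_of_mem (f := g) hx
  rw [Submodule.map_smul''] at h
  exact Submodule.smul_mono le_rfl le_top h

lemma basis_mem_smul_top {R K ι : Type*} [CommRing R] [AddCommGroup K] [Module R K]
    (b : Module.Basis ι R K) (I : Ideal R) {x : K} :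
    x ∈ I • (⊤ : Submodule R K) ↔ ∀ i, b.repr x i ∈ I := by
  constructor
  · intro hx i
    have h := map_mem_smul_top (b.coord i) I hx
    simpa using h
  · intro h
    rw [← b.linearCombination_repr x, Finsupp.linearCombination_apply]
    exact Submodule.sum_mem _ fun i _ => Submodule.smul_mem_smul (h i) trivial

lemma del_mem {R M : Type*} [CommRing R] [AddCommGroup M] [Module R M]
    (φ : Module.Dual R M) (x : ExteriorAlgebra R M) :
    del φ x ∈ (LinearMap.range φ : Ideal R) • (⊤ : Submodule R (ExteriorAlgebra R M)) := by
  induction x using CliffordAlgebra.left_induction with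
  | algebraMap r => simp [del]
  | add x y hx hy => rw [map_add]; exact add_mem hx hy
  | ι_mul x m hx =>
    rw [del, CliffordAlgebra.contractLeft_ι_mul]
    refine sub_mem (Submodule.smul_mem_smul ⟨m, rfl⟩ trivial) ?_
    exact map_mem_smul_top (LinearMap.mulLeft R (CliffordAlgebra.ι (0 : QuadraticForm R M) m)) _ hx

lemma koszul_step {R : Type*} [CommRing R] {m : ℕ} (φ : Module.Dual R (Fin m → R))
    (a : ℕ → R) (c : ℕ → (Fin m → R)) (hc : ∀ j, j < m → φ (c j) = a j)
    (hreg : ∀ j, j < m → ∀ g, a j * g ∈ Ideal.span (a '' {i | i < j}) →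
      g ∈ Ideal.span (a '' {i | i < j})) (k : ℕ) :
    ∀ j, j + k = m → ∀ z ∈ ⋀[R]^(j + 1) (Fin m → R),
      del φ z ∈ Ideal.span (a '' {i | i < j}) • (⊤ : Submodule R (ExteriorAlgebra R (Fin m → R))) →
      ∃ u, z - del φ u ∈ Ideal.span (a '' {i | i < j}) •
        (⊤ : Submodule R (ExteriorAlgebra R (Fin m → R))) := by
  induction k with
  | zero =>
    intro j hj z hz _
    have hz0 : z = 0 := by
      have hb := (Pi.basisFun R (Fin m)).exteriorPower (j + 1)
      have : IsEmpty (Set.powersetCard (Fin m) (j + 1)) := by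
        constructor
        rintro ⟨s, hs⟩
        have h1 := Finset.card_le_univ s
        have h2 : s.card = j + 1 := hs
        simp at h1
        omega
      have hs : Subsingleton (⋀[R]^(j + 1) (Fin m → R)) := hb.repr.toEquiv.subsingleton
      have := Subsingleton.elim (⟨z, hz⟩ : ⋀[R]^(j + 1) (Fin m → R)) 0
      simpa using congrArg Subtype.val this
    exact ⟨0, by simp [hz0]⟩
  | succ k ih =>
    intro j hj z hz hdz
    have hI : Ideal.span (a '' {i | i < j + 1}) =
        Ideal.span {a j} ⊔ Ideal.span (a '' {i | i < j}) := by
      rw [← Ideal.span_union]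
      congr 1
      ext x
      simp only [Set.mem_image, Set.mem_union, Set.mem_singleton_iff, Set.mem_ofPred_eq,
        Order.lt_add_one_iff, le_iff_eq_or_lt]
      constructor
      · rintro ⟨i, rfl | hi, rfl⟩
        · exact Or.inl rfl
        · exact Or.inr ⟨i, hi, rfl⟩
      · rintro (rfl | ⟨i, hi, rfl⟩)
        · exact ⟨j, Or.inl rfl, rfl⟩
        · exact ⟨i, Or.inr hi, rfl⟩
    have hw : del φ (ExteriorAlgebra.ι R (c j) * z) =
        a j • z - ExteriorAlgebra.ι R (c j) * del φ z := by
      rw [← hc j (by omega)]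
      exact CliffordAlgebra.contractLeft_ι_mul _ _ _
    have hcd : ExteriorAlgebra.ι R (c j) * del φ z ∈ Ideal.span (a '' {i | i < j}) •
        (⊤ : Submodule R (ExteriorAlgebra R (Fin m → R))) :=
      map_mem_smul_top (LinearMap.mulLeft R (ExteriorAlgebra.ι R (c j))) _ hdz
    obtain ⟨u, hu⟩ := ih (j + 1) (by omega) (ExteriorAlgebra.ι R (c j) * z)
      (by
        rw [ExteriorAlgebra.exteriorPower, pow_succ']
        exact Submodule.mul_mem_mul ⟨c j, rfl⟩ hz)
      (by
        rw [hw, hI, Submodule.sup_smul]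
        refine sub_mem ?_ (Submodule.mem_sup_right hcd)
        exact Submodule.mem_sup_left
          (Submodule.smul_mem_smul (Ideal.mem_span_singleton_self _) trivial))
    rw [hI, Submodule.sup_smul, Submodule.mem_sup] at hu
    obtain ⟨y, hy, i, hi, hyi⟩ := hu
    rw [Submodule.ideal_span_singleton_smul, Submodule.mem_smul_pointwise_iff_exists] at hy
    obtain ⟨v, -, rfl⟩ := hy
    refine ⟨v, ?_⟩
    have h1 := congrArg (del φ) hyi
    rw [map_sub, hw, map_add, map_smul] at h1
    have h2 : del φ (del φ u) = 0 := CliffordAlgebra.contractLeft_contractLeft _ _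
    have h3 : a j • (z - del φ v) = del φ i + ExteriorAlgebra.ι R (c j) * del φ z := by
      rw [h2, sub_zero] at h1
      rw [smul_sub, sub_eq_iff_eq_add]
      rw [eq_sub_iff_add_eq] at h1
      rw [← h1]; abel
    have h4 : a j • (z - del φ v) ∈ Ideal.span (a '' {i | i < j}) •
        (⊤ : Submodule R (ExteriorAlgebra R (Fin m → R))) := by
      rw [h3]; exact add_mem (map_mem_smul_top _ _ hi) hcd
    rw [basis_mem_smul_top (Pi.basisFun R (Fin m)).ExteriorAlgebra] at h4 ⊢
    intro s
    refine hreg j (by omega) _ ?_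
    simpa using h4 s

/-- Syzygies of a sequence of length `m` generating an ideal which contains a regular
sequence of length `m` have coefficients in that ideal. -/
lemma syzygy_mem {R : Type*} [CommRing R] {m : ℕ} (f : Fin m → R)
    (a : ℕ → R) (ha : ∀ j, j < m → a j ∈ Ideal.span (Set.range f))
    (hreg : ∀ j, j < m → ∀ g, a j * g ∈ Ideal.span (a '' {i | i < j}) →
      g ∈ Ideal.span (a '' {i | i < j}))
    (A : Fin m → R) (hA : ∑ i, A i * f i = 0) (i : Fin m) :
    A i ∈ Ideal.span (Set.range f) := by
  let φ : Module.Dual R (Fin m → R) := Fintype.linearCombination R f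
  have hφ : ∀ v, φ v = ∑ i, v i * f i := fun v => by
    simp [φ, Fintype.linearCombination_apply]
  have hr : (LinearMap.range φ : Ideal R) = Ideal.span (Set.range f) :=
    Fintype.range_linearCombination R f
  have hex : ∀ j, ∃ c, j < m → φ c = a j := by
    intro j
    by_cases hj : j < m
    · have := ha j hj
      rw [← hr] at this
      obtain ⟨c, hc⟩ := this
      exact ⟨c, fun _ => hc⟩
    · exact ⟨0, fun h => absurd h hj⟩
  choose c hc using hex
  obtain ⟨u, hu⟩ := koszul_step φ a c hc hreg m 0 (by simp) (ExteriorAlgebra.ι R A)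
    (by simp [ExteriorAlgebra.exteriorPower])
    (by
      have : del φ (ExteriorAlgebra.ι R A) = 0 := by
        refine (CliffordAlgebra.contractLeft_ι _ _ _).trans ?_
        rw [hφ, hA, map_zero]
      rw [this]; exact zero_mem _)
  have hu' : ExteriorAlgebra.ι R A = del φ u := by
    simpa [sub_eq_zero] using hu
  have h := del_mem φ u
  rw [← hu', hr] at h
  have h2 := map_mem_smul_top (((LinearMap.proj i : (Fin m → R) →ₗ[R] R)).comp
    (ExteriorAlgebra.ιInv : ExteriorAlgebra R (Fin m → R) →ₗ[R] (Fin m → R))) _ h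
  have h3 : ExteriorAlgebra.ιInv (ExteriorAlgebra.ι R A) = A := ExteriorAlgebra.ι_leftInverse A
  simpa [h3] using h2

lemma X_pow_regular {m : ℕ} (N : Fin m → ℕ) (j : Fin m) (s : Set (Fin m)) (hj : j ∉ s)
    (g : MvPolynomial (Fin m) ℂ)
    (h : X j ^ N j * g ∈ Ideal.span ((fun i => (X i ^ N i : MvPolynomial (Fin m) ℂ)) '' s)) :
    g ∈ Ideal.span ((fun i => (X i ^ N i : MvPolynomial (Fin m) ℂ)) '' s) := by
  have e : (fun i => (X i ^ N i : MvPolynomial (Fin m) ℂ)) '' s =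
      (fun t => monomial t (1 : ℂ)) '' ((fun i => Finsupp.single i (N i)) '' s) := by
    rw [Set.image_image]
    simp only [X_pow_eq_monomial]
  rw [e, mem_ideal_span_monomial_image] at h ⊢
  intro t ht
  obtain ⟨_, ⟨i, hi, rfl⟩, hle⟩ := h (Finsupp.single j (N j) + t) (by
    rw [mem_support_iff, X_pow_eq_monomial, coeff_monomial_mul, one_mul]
    exact mem_support_iff.mp ht)
  refine ⟨_, ⟨i, hi, rfl⟩, ?_⟩
  have hij : j ≠ i := fun h => hj (h ▸ hi)
  rw [Finsupp.single_le_iff] at hle ⊢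
  simpa [Finsupp.single_apply, hij] using hle

lemma eq_zero_of_mem_span {m e k : ℕ} (f : Fin m → MvPolynomial (Fin m) ℂ)
    (hf : ∀ i, (f i).IsHomogeneous e) (hk : k < e) (p : MvPolynomial (Fin m) ℂ)
    (hp : p.IsHomogeneous k) (hmem : p ∈ Ideal.span (Set.range f)) : p = 0 := by
  obtain ⟨c, rfl⟩ := (Ideal.mem_span_range_iff_exists_fun).mp hmem
  ext t
  by_contra hne
  rw [coeff_zero] at hne
  have hdeg := hp hne
  apply hne
  rw [coeff_sum]
  refine Finset.sum_eq_zero fun i _ => ?_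
  rw [coeff_mul]
  refine Finset.sum_eq_zero fun x hx => ?_
  by_cases h0 : coeff x.2 (f i) = 0
  · rw [h0, mul_zero]
  · exfalso
    have h1 := hf i h0
    rw [Finset.HasAntidiagonal.mem_antidiagonal] at hx
    rw [← hx, map_add] at hdeg
    omega

lemma syzygy_zero {m e k : ℕ} (f : Fin m → MvPolynomial (Fin m) ℂ)
    (hf : ∀ i, (f i).IsHomogeneous e) (hk : k < e)
    (hsm : ∀ x : Fin m → ℂ, (∀ i, eval x (f i) = 0) → x = 0)
    (A : Fin m → MvPolynomial (Fin m) ℂ) (hA : ∀ i, (A i).IsHomogeneous k)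
    (h : ∑ i, A i * f i = 0) (i : Fin m) : A i = 0 := by
  have hN : ∀ j : Fin m, ∃ N : ℕ,
      (X j ^ N : MvPolynomial (Fin m) ℂ) ∈ Ideal.span (Set.range f) := by
    intro j
    have : (X j : MvPolynomial (Fin m) ℂ) ∈ (Ideal.span (Set.range f)).radical := by
      rw [← vanishingIdeal_zeroLocus_eq_radical (K := ℂ), mem_vanishingIdeal_iff]
      intro x hx
      have hx0 : x = 0 := hsm x fun i => by
        have := hx (f i) (Ideal.subset_span ⟨i, rfl⟩)
        simpa [aeval_eq_eval] using this
      simp [hx0]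
    exact this
  choose N hN using hN
  refine eq_zero_of_mem_span f hf hk _ (hA i) ?_
  let a : ℕ → MvPolynomial (Fin m) ℂ := fun j => if hj : j < m then X ⟨j, hj⟩ ^ N ⟨j, hj⟩ else 0
  have himg : ∀ j, j < m → a '' {i | i < j} =
      (fun i => (X i ^ N i : MvPolynomial (Fin m) ℂ)) '' {i : Fin m | (i : ℕ) < j} := by
    intro j hj
    ext p
    constructor
    · rintro ⟨i, hi, rfl⟩
      have hi' : i < j := hi
      exact ⟨⟨i, by omega⟩, hi, by simp [a, show i < m by omega]⟩
    · rintro ⟨i, hi, rfl⟩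
      exact ⟨i, hi, by simp [a]⟩
  refine syzygy_mem f a (fun j hj => ?_) (fun j hj g hg => ?_) A h i
  · simpa [a, hj] using hN ⟨j, hj⟩
  · rw [himg j hj] at hg ⊢
    refine X_pow_regular N ⟨j, hj⟩ _ (by simp) g ?_
    simpa [a, hj] using hg

end KoszulAux

theorem ker_h_eq_im_E_smooth
    (n d : ℕ) (hn : 1 ≤ n) (hd : 1 ≤ d)
    (F : MvPolynomial (Fin (n + 2)) ℂ) (hF : F.IsHomogeneous d)
    (hsm : ∀ x : Fin (n + 2) → ℂ, (∀ i, eval x (pderiv i F) = 0) → x = 0)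
    (A : Fin (n + 2) → MvPolynomial (Fin (n + 2)) ℂ)
    (hA : ∀ i, A i ∈ gradedPiece n ((d : ℤ) - n - 1))
    (hker : ∃ C ∈ gradedPiece n ((d : ℤ) - n - 2),
      ∑ i, A i * pderiv i F = F * C) :
    ∃ B ∈ gradedPiece n ((d : ℤ) - n - 2), ∀ i, A i = X i * B := by
  obtain ⟨C, hC, hsum⟩ := hker
  refine ⟨(d : ℂ)⁻¹ • C, Submodule.smul_mem _ _ hC, fun i => ?_⟩
  have hd0 : (d : ℂ) ≠ 0 := by exact_mod_cast (by omega : d ≠ 0)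
  by_cases hdn : n + 1 ≤ d
  · have hA' : ∀ i, (A i).IsHomogeneous (d - n - 1) := by
      intro i
      have := hA i
      rw [gradedPiece, if_pos (by omega), mem_homogeneousSubmodule] at this
      rwa [show ((d : ℤ) - n - 1).toNat = d - n - 1 by omega] at this
    have hC' : ∀ i : Fin (n + 2), (X i * C).IsHomogeneous (d - n - 1) := by
      intro i
      by_cases h2 : n + 2 ≤ d
      · rw [gradedPiece, if_pos (by omega), mem_homogeneousSubmodule] at hC
        have h3 := (isHomogeneous_X ℂ i).mul hC
        rwa [show 1 + ((d : ℤ) - n - 2).toNat = d - n - 1 by omega] at h3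
      · rw [gradedPiece, if_neg (by omega), Submodule.mem_bot] at hC
        rw [hC, mul_zero]; exact isHomogeneous_zero _ _ _
    have key := KoszulAux.syzygy_zero (e := d - 1) (k := d - n - 1) (fun i => pderiv i F)
      (fun i => hF.pderiv) (by omega) hsm (fun i => A i - X i * ((d : ℂ)⁻¹ • C))
      (fun i => (hA' i).sub (by
        rw [mul_smul_comm]
        exact (homogeneousSubmodule _ ℂ _).smul_mem _ (hC' i)))
      (by
        have hE := hF.sum_X_mul_pderiv
        simp only [sub_mul, Finset.sum_sub_distrib, hsum]
        have : ∑ i, X i * ((d : ℂ)⁻¹ • C) * pderiv i F =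
            (d : ℂ)⁻¹ • (C * ∑ i, X i * pderiv i F) := by
          rw [Finset.mul_sum, Finset.smul_sum]
          refine Finset.sum_congr rfl fun i _ => ?_
          simp only [smul_eq_C_mul]; ring
        rw [this, hE, ← Nat.cast_smul_eq_nsmul ℂ, mul_smul_comm, smul_smul,
          inv_mul_cancel₀ hd0, one_smul, mul_comm, sub_self]) i
    exact sub_eq_zero.mp key
  · have h1 := hA i
    rw [gradedPiece, if_neg (by omega), Submodule.mem_bot] at h1
    rw [gradedPiece, if_neg (by omega), Submodule.mem_bot] at hC
    rw [h1, hC, smul_zero, mul_zero]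
end
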